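/- (Abstract matrix-tree theorem for diagonal minors.) For every subset I ⊆ {1,…,n}, the Laplace operator applied to the universal diagonal I-minor satisfies Δ(det_{n,k}^I) = ((−1)^n / k!) · U(AC_{n,k}^I) in Graph_{n,k}. -/

import Mathlib

open Finset

open scoped Classical Nat

noncomputable section

/-- A directed graph with `n` labeled vertices and `k` labeled edges:
the `ℓ`-th edge is the ordered pair `G ℓ = (a, b)` (an edge from `a` to `b`; loops allowed). -/
abbrev DG (n k : ℕ) := Fin k → Fin n × Fin n

namespace DG

variable {n k : ℕ}

/-- `step G S a b`: the subgraph of `G` with edge-label set `S` has an edge from `a` to `b`. -/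
def step (G : DG n k) (S : Finset (Fin k)) (a b : Fin n) : Prop :=
  ∃ e ∈ S, G e = (a, b)

/-- The subgraph of `G` with edge-label set `S` contains no directed cycle. -/
def Acyclic (G : DG n k) (S : Finset (Fin k)) : Prop :=
  ∀ a : Fin n, ¬ Relation.TransGen (step G S) a a

/-- The edge `e` lies on a directed cycle of the subgraph of `G` with edge set `S`
(equivalently, there is a directed path from the head of `e` back to its tail). -/
def OnCycle (G : DG n k) (S : Finset (Fin k)) (e : Fin k) : Prop :=
  Relation.ReflTransGen (step G S) (G e).2 (G e).1

/-- Strongly semiconnected: every edge lies on a directed cycle. -/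
def SSC (G : DG n k) (S : Finset (Fin k)) : Prop :=
  ∀ e ∈ S, OnCycle G S e

/-- Strongly connected: every ordered pair of vertices is joined by a directed path. -/
def StronglyConnected (G : DG n k) (S : Finset (Fin k)) : Prop :=
  ∀ a b : Fin n, Relation.ReflTransGen (step G S) a b

/-- Adjacency in the underlying undirected graph. -/
def adj (G : DG n k) (S : Finset (Fin k)) (a b : Fin n) : Prop :=
  ∃ e ∈ S, G e = (a, b) ∨ G e = (b, a)

/-- `β₀`: the number of connected components of the underlying undirected graph
(isolated vertices count as components). -/
def beta0 (G : DG n k) (S : Finset (Fin k)) : ℕ :=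
  Nat.card (Quot (adj G S))

/-- `α(H) = (−1)^{#edges}` if `H` is acyclic, `0` otherwise. -/
def alpha (G : DG n k) (S : Finset (Fin k)) : ℤ :=
  if Acyclic G S then (-1) ^ S.card else 0

/-- `σ(H) = (−1)^{β₁}` if `H` is strongly semiconnected, `0` otherwise;
here `β₁ = #edges − n + β₀`, and `(−1)^{#edges − n + β₀} = (−1)^{#edges + n + β₀}`. -/
def sigma (G : DG n k) (S : Finset (Fin k)) : ℤ :=
  if SSC G S then (-1) ^ (S.card + n + beta0 G S) else 0

/-- The vertex `v` is isolated: incident to no edge. -/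
def isolated (G : DG n k) (v : Fin n) : Prop :=
  ∀ e : Fin k, (G e).1 ≠ v ∧ (G e).2 ≠ v

/-- The vertex `v` is a sink: no edge starts at it. -/
def isSink (G : DG n k) (v : Fin n) : Prop :=
  ∀ e : Fin k, (G e).1 ≠ v

end DG
/-- `Graph_{n,k}`: the vector space over `R` with basis `Γ_{n,k}`. -/
abbrev GS (R : Type*) [Semiring R] (n k : ℕ) := DG n k →₀ R

namespace DG

variable {R : Type*}

/-- Action of the operator `B_p` on a basis graph `G`: identity if the `p`-th edge is not a
loop, and `−∑_{b ≠ a} R_{ab;p} G` if it is the loop `[aa]`. -/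
noncomputable def Bsingle [CommRing R] (n k : ℕ) (p : Fin k) (G : DG n k) : GS R n k :=
  if (G p).1 = (G p).2 then
    - ∑ b ∈ Finset.univ.filter (fun b => b ≠ (G p).1),
        Finsupp.single (Function.update G p ((G p).1, b)) (1 : R)
  else Finsupp.single G 1

/-- The linear operator `B_p : Graph_{n,k} → Graph_{n,k}`. -/
noncomputable def B [CommRing R] (n k : ℕ) (p : Fin k) : GS R n k →ₗ[R] GS R n k :=
  Finsupp.lsum R fun G => LinearMap.toSpanSingleton R (GS R n k) (Bsingle n k p G)

/-- The Laplace operator `Δ = B_1 ⋯ B_k` (identity when `k = 0`). -/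
noncomputable def Laplace [CommRing R] (n k : ℕ) : GS R n k →ₗ[R] GS R n k :=
  (List.ofFn fun p : Fin k => B (R := R) n k p).prod

/-- `U(𝔅) = ∑_{G ∈ 𝔅} G`. -/
noncomputable def U (R : Type*) [CommRing R] (n k : ℕ) (P : DG n k → Prop) : GS R n k :=
  ∑ G : DG n k, if P G then Finsupp.single G (1 : R) else 0

/-- `X(𝔅) = ∑_{G ∈ 𝔅} (−1)^{β₀(G)} G`. -/
noncomputable def X (R : Type*) [CommRing R] (n k : ℕ) (P : DG n k → Prop) : GS R n k :=
  ∑ G : DG n k, if P G then Finsupp.single G ((-1 : R) ^ beta0 G Finset.univ) else 0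

/-- `SSC_{n,k}^I`: strongly semiconnected graphs whose set of isolated vertices is exactly `I`. -/
def SSCset (n k : ℕ) (I : Finset (Fin n)) : DG n k → Prop :=
  fun G => SSC G Finset.univ ∧ {v | isolated G v} = (I : Set (Fin n))

/-- `AC_{n,k}^I`: acyclic graphs whose set of sinks is exactly `I`. -/
def ACset (n k : ℕ) (I : Finset (Fin n)) : DG n k → Prop :=
  fun G => Acyclic G Finset.univ ∧ {v | isSink G v} = (I : Set (Fin n))

/-- The universal diagonal `I`-minor `det_{n,k}^I = ((−1)^k / k!) · X(SSC_{n,k}^I)`. -/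
noncomputable def detI (R : Type*) [Field R] (n k : ℕ) (I : Finset (Fin n)) : GS R n k :=
  (((-1 : R) ^ k) / (k ! : R)) • X R n k (SSCset n k I)

/-- The universal `(i,j)`-minor
`det_{n,k}^{i/j} = ((−1)^k / k!) · X({G : ([ij])*G ∈ SSC_{n,k+1}^∅})`. -/
noncomputable def detIJ (R : Type*) [Field R] (n k : ℕ) (i j : Fin n) : GS R n k :=
  (((-1 : R) ^ k) / (k ! : R)) •
    X R n k (fun G => SSCset n (k + 1) (∅ : Finset (Fin n)) (Fin.cons (i, j) G))

/-- The pairing `⟨W | G⟩ = ∏_{[ij] ∈ G} w_{ij}`, extended linearly to `Graph_{n,k}`. -/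
noncomputable def pair [CommRing R] {n k : ℕ} (W : Matrix (Fin n) (Fin n) R)
    (x : GS R n k) : R :=
  x.sum fun G c => c * ∏ e : Fin k, W (G e).1 (G e).2

/-- The Laplace matrix `Ŵ` of `W`: off-diagonal entries `w_{ij}`, diagonal entries
`−∑_{j ≠ i} w_{ij}`. -/
def lapMat [CommRing R] {n : ℕ} (W : Matrix (Fin n) (Fin n) R) : Matrix (Fin n) (Fin n) R :=
  Matrix.of fun i j =>
    if i = j then - ∑ l ∈ Finset.univ.filter (fun l => l ≠ i), W i l else W i j

end DG

namespace DG

section CycleCore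

variable {n k : ℕ} {G : DG n k} {S : Finset (Fin k)}

/-- Reachability by directed paths using only edges with label in `S`. -/
def Reach (G : DG n k) (S : Finset (Fin k)) : Fin n → Fin n → Prop :=
  Relation.ReflTransGen (step G S)

lemma Reach.of_mem {e : Fin k} (he : e ∈ S) : Reach G S (G e).1 (G e).2 :=
  .single ⟨e, he, rfl⟩

lemma step.mono {T : Finset (Fin k)} (h : S ⊆ T) {a b : Fin n} :
    step G S a b → step G T a b :=
  fun ⟨e, he, h'⟩ => ⟨e, h he, h'⟩

lemma SSC.reach_symm (h : SSC G S) {a b : Fin n} (hab : Reach G S a b) : Reach G S b a := by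
  induction hab with
  | refl => exact .refl
  | tail _ hs ih =>
    obtain ⟨e, he, h'⟩ := hs
    have := h e he
    rw [OnCycle, h'] at this
    exact Relation.ReflTransGen.trans this ih

/-- In a strongly semiconnected graph, being in the same component amounts to reachability. -/
lemma SSC.eqvGen_adj_iff (h : SSC G S) (a b : Fin n) :
    Relation.EqvGen (adj G S) a b ↔ Reach G S a b := by
  constructor
  · intro hab
    induction hab with
    | rel x y hxy =>
      obtain ⟨e, he, h' | h'⟩ := hxy
      · simpa [h'] using Reach.of_mem (G := G) he
      · exact h.reach_symm (by simpa [h'] using Reach.of_mem (G := G) he)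
    | refl => exact .refl
    | symm _ _ _ ih => exact h.reach_symm ih
    | trans _ _ _ _ _ ih₁ ih₂ => exact Relation.ReflTransGen.trans ih₁ ih₂
  · intro hab
    induction hab with
    | refl => exact .refl _
    | tail _ hs ih =>
      obtain ⟨e, he, h'⟩ := hs
      exact .trans _ _ _ ih (.rel _ _ ⟨e, he, .inl h'⟩)

lemma card_quot_eq_card_image {α : Type*} [Fintype α] (r : α → α → Prop) :
    Nat.card (Quot r) =
      (univ.image fun a : α => univ.filter fun b => Relation.EqvGen r a b).card := by
  set f : α → Finset α := fun a => univ.filter fun b => Relation.EqvGen r a b with hf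
  have hfr : ∀ a b, f a = f b ↔ Relation.EqvGen r a b := by
    refine fun a b => ⟨fun h => ?_, fun h => ?_⟩
    · have : b ∈ f b := by simpa [hf] using .refl b
      rw [← h] at this
      simpa [hf] using this
    · ext c
      simp only [hf, mem_filter, mem_univ, true_and]
      exact ⟨.trans _ _ _ (.symm _ _ h), .trans _ _ _ h⟩
  rw [← Fintype.card_coe, ← Nat.card_eq_fintype_card]
  refine Nat.card_eq_of_bijective (Quot.lift
    (fun a => (⟨f a, mem_image_of_mem f (mem_univ a)⟩ : univ.image f))
    fun a b h => Subtype.ext ((hfr a b).2 (.rel _ _ h))) ⟨?_, ?_⟩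
  · rintro ⟨a⟩ ⟨b⟩ h
    exact Quot.eqvGen_sound ((hfr a b).1 (congrArg Subtype.val h))
  · rintro ⟨_, h⟩
    obtain ⟨a, -, rfl⟩ := mem_image.1 h
    exact ⟨Quot.mk _ a, rfl⟩

/-- The edges with label in `S` whose tail lies in `W`. -/
def outOf (G : DG n k) (S : Finset (Fin k)) (W : Finset (Fin n)) : Finset (Fin k) :=
  S.filter fun e => (G e).1 ∈ W

/-- `W` is closed under the edges in `S`, and those starting in `W` form a strongly
semiconnected graph. -/
def IsTerminal (G : DG n k) (S : Finset (Fin k)) (W : Finset (Fin n)) : Prop :=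
  (∀ e ∈ outOf G S W, (G e).2 ∈ W) ∧ SSC G (outOf G S W)

lemma reach_outOf_iff {W : Finset (Fin n)} (hW : ∀ e ∈ outOf G S W, (G e).2 ∈ W) (a b : Fin n) :
    Reach G (outOf G S W) a b ↔ a = b ∨ a ∈ W ∧ b ∈ W ∧ Reach G S a b := by
  constructor
  · intro h
    induction h with
    | refl => exact .inl rfl
    | @tail b c _ hs ih =>
      obtain ⟨e, he, h'⟩ := hs
      have h1 := hW e he
      have h2 : b ∈ W ∧ e ∈ S := by
        simp only [outOf, mem_filter, h'] at he
        exact ⟨he.2, he.1⟩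
      have h3 : Reach G S b c := by simpa [h'] using Reach.of_mem (G := G) h2.2
      rw [h'] at h1
      rcases ih with rfl | ⟨ha, _, hr⟩
      · exact .inr ⟨h2.1, h1, h3⟩
      · exact .inr ⟨ha, h1, hr.trans h3⟩
  · rintro (rfl | ⟨ha, -, hr⟩)
    · exact .refl
    · suffices Reach G (outOf G S W) a b ∧ b ∈ W from this.1
      induction hr with
      | refl => exact ⟨.refl, ha⟩
      | tail _ hs ih =>
        obtain ⟨e, he, h'⟩ := hs
        have hm : e ∈ outOf G S W := by simp [outOf, he, h', ih.2]
        exact ⟨ih.1.tail ⟨e, hm, h'⟩, by simpa [h'] using hW e hm⟩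

lemma isTerminal_iff {W : Finset (Fin n)} :
    IsTerminal G S W ↔ ∀ v ∈ W, ∀ w, Reach G S v w → w ∈ W ∧ Reach G S w v := by
  constructor
  · rintro ⟨h1, h2⟩ v hv w hr
    have key : w ∈ W := by
      induction hr with
      | refl => exact hv
      | tail _ hs ih =>
        obtain ⟨e, he, h'⟩ := hs
        simpa [h'] using h1 e (by simp [outOf, he, h', ih])
    have := h2.reach_symm ((reach_outOf_iff h1 v w).2 (.inr ⟨hv, key, hr⟩))
    rcases (reach_outOf_iff h1 w v).1 this with rfl | h
    · exact ⟨key, .refl⟩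
    · exact ⟨key, h.2.2⟩
  · intro h
    have h1 : ∀ e ∈ outOf G S W, (G e).2 ∈ W := fun e he => by
      simp only [outOf, mem_filter] at he
      exact (h _ he.2 _ (Reach.of_mem he.1)).1
    refine ⟨h1, fun e he => ?_⟩
    have he' := he
    simp only [outOf, mem_filter] at he'
    exact (reach_outOf_iff h1 _ _).2
      (.inr ⟨h1 e he, he'.2, (h _ he'.2 _ (Reach.of_mem he'.1)).2⟩)

/-- Merging the singleton classes of the elements of `C` into one class. -/
lemma card_quot_merge {α : Type*} [Fintype α] {r s : α → α → Prop} {C : Finset α}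
    (hC : C.Nonempty)
    (hr : ∀ a ∈ C, ∀ b, Relation.EqvGen r a b ↔ a = b)
    (hs : ∀ a ∈ C, ∀ b, Relation.EqvGen s a b ↔ b ∈ C)
    (hrs : ∀ a ∉ C, ∀ b, Relation.EqvGen r a b ↔ Relation.EqvGen s a b) :
    Nat.card (Quot s) + C.card = Nat.card (Quot r) + 1 := by
  have hsplit : ∀ t : α → α → Prop,
      (∀ a ∈ C, ∀ b, Relation.EqvGen t a b → b ∈ C) →
      (univ.image fun a : α => univ.filter fun b => Relation.EqvGen t a b).card =
        (C.image fun a : α => univ.filter fun b => Relation.EqvGen t a b).card +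
        (Cᶜ.image fun a : α => univ.filter fun b => Relation.EqvGen t a b).card := by
    intro t ht
    rw [← card_union_of_disjoint, ← image_union, union_compl]
    rw [disjoint_left]
    simp only [mem_image, mem_compl, not_exists, not_and]
    rintro _ ⟨a, ha, rfl⟩ b hb hab
    have : b ∈ univ.filter fun c => Relation.EqvGen t b c := by simpa using .refl b
    rw [hab] at this
    exact hb (ht a ha b (by simpa using this))
  rw [card_quot_eq_card_image, card_quot_eq_card_image,
    hsplit s (fun a ha b h => (hs a ha b).1 h),
    hsplit r (fun a ha b h => (hr a ha b).1 h ▸ ha)]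
  have h1 : (C.image fun a : α => univ.filter fun b => Relation.EqvGen s a b) = {C} := by
    ext D
    simp only [mem_image, mem_singleton]
    have : ∀ a ∈ C, (univ.filter fun b => Relation.EqvGen s a b) = C := fun a ha => by
      ext b; simp [hs a ha]
    constructor
    · rintro ⟨a, ha, rfl⟩; exact this a ha
    · rintro rfl; exact hC.imp fun a ha => ⟨ha, this a ha⟩
  have h2 : (C.image fun a : α => univ.filter fun b => Relation.EqvGen r a b).card = C.card := by
    refine card_image_of_injOn fun a ha b hb hab => ?_
    have : b ∈ univ.filter fun c => Relation.EqvGen r b c := by simpa using .refl b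
    beta_reduce at hab
    rw [← hab] at this
    exact (hr a ha b).1 (by simpa using this)
  have h3 : (Cᶜ.image fun a : α => univ.filter fun b => Relation.EqvGen r a b) =
      Cᶜ.image fun a : α => univ.filter fun b => Relation.EqvGen s a b := by
    refine image_congr fun a ha => ?_
    ext b
    simp [hrs a (by simpa using ha)]
  rw [h1, h2, h3, card_singleton]
  omega

/-- Some vertex of a nonempty set closed under the edges in `S` lies in a terminal strong
component. -/
lemma exists_terminal_vertex {U : Finset (Fin n)} (hU : U.Nonempty)
    (hS : ∀ e ∈ S, (G e).2 ∈ U) :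
    ∃ c ∈ U, ∀ w, Reach G S c w → w ∈ U ∧ Reach G S w c := by
  obtain ⟨c, hc, hmin⟩ := exists_min_image U
    (fun c => (univ.filter fun w => Reach G S c w).card) hU
  refine ⟨c, hc, fun w hw => ?_⟩
  have hwU : w ∈ U := by
    cases hw with
    | refl => exact hc
    | tail _ hs => obtain ⟨e, he, h'⟩ := hs; simpa [h'] using hS e he
  refine ⟨hwU, ?_⟩
  have hsub : (univ.filter fun x => Reach G S w x) ⊆ univ.filter fun x => Reach G S c x := by
    intro x
    simp only [mem_filter, mem_univ, true_and]
    exact Relation.ReflTransGen.trans hw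
  have : c ∈ univ.filter fun x => Reach G S w x := by
    rw [eq_of_subset_of_card_le hsub (hmin w hwU)]
    simpa using .refl
  simpa using this

lemma IsTerminal.union_component {W C : Finset (Fin n)} {c : Fin n} (hW : IsTerminal G S W)
    (hC : ∀ w, w ∈ C ↔ Reach G S c w) (hc : ∀ w, Reach G S c w → Reach G S w c) :
    IsTerminal G S (W ∪ C) := by
  rw [isTerminal_iff] at hW ⊢
  intro v hv w hr
  rcases mem_union.1 hv with hv | hv
  · exact ⟨mem_union_left _ (hW v hv w hr).1, (hW v hv w hr).2⟩
  · have hv' := (hC v).1 hv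
    have hw : Reach G S c w := hv'.trans hr
    exact ⟨mem_union_right _ ((hC w).2 hw), (hc w hw).trans hv'⟩

/-- Adjoining a terminal strong component to a terminal set disjoint from it. -/
lemma beta0_outOf_union {W C : Finset (Fin n)} {c : Fin n} (hW : IsTerminal G S W)
    (hcW : c ∉ W) (hC : ∀ w, w ∈ C ↔ Reach G S c w)
    (hc : ∀ w, Reach G S c w → Reach G S w c) :
    beta0 G (outOf G S (W ∪ C)) + C.card = beta0 G (outOf G S W) + 1 := by
  have hW' := isTerminal_iff.1 hW
  have hdisj : ∀ v ∈ C, v ∉ W := fun v hv hvW =>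
    hcW (hW' v hvW c (hc v ((hC v).1 hv))).1
  have hWC : IsTerminal G S (W ∪ C) := hW.union_component hC hc
  refine card_quot_merge ⟨c, (hC c).2 .refl⟩ ?_ ?_ ?_
  · intro a ha b
    rw [hW.2.eqvGen_adj_iff, reach_outOf_iff hW.1]
    simp [hdisj a ha]
  · intro a ha b
    have ha' := (hC a).1 ha
    rw [hWC.2.eqvGen_adj_iff, reach_outOf_iff hWC.1]
    constructor
    · rintro (rfl | ⟨-, -, h⟩)
      · exact ha
      · exact (hC b).2 (ha'.trans h)
    · intro hb
      exact .inr ⟨mem_union_right _ ha, mem_union_right _ hb, (hc a ha').trans ((hC b).1 hb)⟩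
  · intro a ha b
    rw [hW.2.eqvGen_adj_iff, reach_outOf_iff hW.1, hWC.2.eqvGen_adj_iff, reach_outOf_iff hWC.1]
    have : a ∈ W → Reach G S a b → b ∈ W := fun h1 h2 => (hW' a h1 b h2).1
    simp only [mem_union]
    tauto

variable {R : Type*} [CommRing R]

/-- The signed count of the terminal subsets of a nonempty closed set of vertices vanishes. -/
lemma sum_isTerminal_eq_zero {U : Finset (Fin n)} (hU : U.Nonempty)
    (hS : ∀ e ∈ S, (G e).2 ∈ U) :
    ∑ W ∈ U.powerset with IsTerminal G S W,
      (-1 : R) ^ (W.card + beta0 G (outOf G S W)) = 0 := by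
  obtain ⟨c, hcU, hc⟩ := exists_terminal_vertex hU hS
  set C : Finset (Fin n) := univ.filter fun w => Reach G S c w with hCdef
  have hC : ∀ w, w ∈ C ↔ Reach G S c w := by simp [hCdef]
  have hcC : c ∈ C := (hC c).2 .refl
  have hCU : C ⊆ U := fun w hw => (hc w ((hC w).1 hw)).1
  have hc' : ∀ w, Reach G S c w → Reach G S w c := fun w hw => (hc w hw).2
  have key : ∀ W, IsTerminal G S W → c ∉ W →
      (-1 : R) ^ (W.card + beta0 G (outOf G S W)) +
        (-1 : R) ^ ((W ∪ C).card + beta0 G (outOf G S (W ∪ C))) = 0 := by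
    intro W hW hcW
    have h1 := beta0_outOf_union hW hcW hC hc'
    have h2 : Disjoint W C := disjoint_right.2 fun v hv hvW =>
      hcW (isTerminal_iff.1 hW v hvW c (hc' v ((hC v).1 hv))).1
    have h3 : (W ∪ C).card + beta0 G (outOf G S (W ∪ C)) =
        W.card + beta0 G (outOf G S W) + 1 := by
      rw [card_union_of_disjoint h2]; omega
    rw [h3, pow_succ]; ring
  have hsub : ∀ W, IsTerminal G S W → c ∈ W → C ⊆ W := fun W hW hcW w hw =>
    (isTerminal_iff.1 hW c hcW w ((hC w).1 hw)).1
  have hsdiff : ∀ W, IsTerminal G S W → IsTerminal G S (W \ C) := by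
    intro W hW
    rw [isTerminal_iff] at hW ⊢
    intro v hv w hr
    rw [mem_sdiff] at hv ⊢
    obtain ⟨h1, h2⟩ := hW v hv.1 w hr
    exact ⟨⟨h1, fun hw => hv.2 ((hC v).2 (((hC w).1 hw).trans h2))⟩, h2⟩
  refine sum_involution (fun W _ => if c ∈ W then W \ C else W ∪ C) ?_ ?_ ?_ ?_
  · intro W hW
    obtain ⟨-, hW⟩ := mem_filter.1 hW
    split_ifs with h
    · have := key (W \ C) (hsdiff W hW) (by simp [hcC])
      rw [sdiff_union_of_subset (hsub W hW h)] at this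
      rw [add_comm, this]
    · exact key W hW h
  · intro W _ _ hEq
    split_ifs at hEq with h
    · rw [← hEq] at h; simp [hcC] at h
    · rw [← hEq] at h; simp [hcC] at h
  · intro W hW
    obtain ⟨hWU, hW⟩ := mem_filter.1 hW
    rw [mem_powerset] at hWU
    rw [mem_filter, mem_powerset]
    split_ifs with h
    · exact ⟨sdiff_subset.trans hWU, hsdiff W hW⟩
    · exact ⟨union_subset hWU hCU, hW.union_component hC hc'⟩
  · intro W hW
    obtain ⟨-, hW⟩ := mem_filter.1 hW
    by_cases h : c ∈ W
    · simp [h, hcC, hsub W hW h]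
    · have h2 : Disjoint W C := disjoint_right.2 fun v hv hvW =>
        h (isTerminal_iff.1 hW v hvW c (hc' v ((hC v).1 hv))).1
      simp [h, hcC, union_sdiff_cancel_right h2]

/-- In a graph whose edges stay in a nonempty set `U` of vertices, none of which is a sink, the
signed count of strongly semiconnected subgraphs vanishes. -/
lemma sum_SSC_eq_zero {E : Finset (Fin k)} {U : Finset (Fin n)} (hU : U.Nonempty)
    (hE : ∀ e ∈ E, (G e).1 ∈ U ∧ (G e).2 ∈ U) (hout : ∀ u ∈ U, ∃ e ∈ E, (G e).1 = u) :
    ∑ S ∈ E.powerset with SSC G S, (-1 : R) ^ (S.card + beta0 G S) = 0 := by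
  have h0 : ∑ S ∈ E.powerset, ∑ W ∈ U.powerset, (if IsTerminal G S W then
      (-1 : R) ^ S.card * (-1) ^ (W.card + beta0 G (outOf G S W)) else 0) = 0 := by
    refine sum_eq_zero fun S hS => ?_
    rw [← sum_filter, ← mul_sum, sum_isTerminal_eq_zero hU, mul_zero]
    exact fun e he => (hE e (mem_powerset.1 hS he)).2
  rw [sum_comm, sum_eq_single_of_mem U (mem_powerset_self U)] at h0
  · have h1 : ∀ S ∈ E.powerset, outOf G S U = S := fun S hS =>
      filter_true_of_mem fun e he => (hE e (mem_powerset.1 hS he)).1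
    have h2 : (-1 : R) ^ U.card *
        ∑ S ∈ E.powerset with SSC G S, (-1 : R) ^ (S.card + beta0 G S) = 0 := by
      rw [← h0, sum_filter, mul_sum]
      refine sum_congr rfl fun S hS => ?_
      have h3 : IsTerminal G S U ↔ SSC G S := by
        rw [IsTerminal, h1 S hS, and_iff_right]
        exact fun e he => (hE e (mem_powerset.1 hS he)).2
      rw [h1 S hS]
      simp only [h3]
      split_ifs <;> ring
    have h3 : IsUnit ((-1 : R) ^ U.card) := isUnit_neg_one.pow _
    exact h3.mul_right_eq_zero.1 h2
  · intro W hW hne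
    obtain ⟨u, huU, huW⟩ := exists_of_ssubset (ssubset_of_subset_of_ne (mem_powerset.1 hW) hne)
    obtain ⟨e, heE, rfl⟩ := hout u huU
    have hins : ∀ S, outOf G (insert e S) W = outOf G S W := fun S => by
      simp [outOf, filter_insert, huW]
    rw [← insert_erase heE, sum_powerset_insert (notMem_erase e E), ← sum_add_distrib]
    refine sum_eq_zero fun S hS => ?_
    have heS : e ∉ S := fun h => notMem_erase e E (mem_powerset.1 hS h)
    have hiff : IsTerminal G (insert e S) W ↔ IsTerminal G S W := by rw [IsTerminal, hins]; rfl
    rw [hins, card_insert_of_notMem heS, pow_succ]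
    simp only [hiff]
    split_ifs <;> ring

lemma SSC.transGen_endpoints (h : SSC G S) {e : Fin k} (he : e ∈ S) :
    Relation.TransGen (step G univ) (G e).1 (G e).1 ∧
      Relation.TransGen (step G univ) (G e).2 (G e).2 := by
  have h1 : step G univ (G e).1 (G e).2 := ⟨e, mem_univ e, rfl⟩
  have h2 : Relation.ReflTransGen (step G univ) (G e).2 (G e).1 :=
    Relation.ReflTransGen.mono (fun _ _ => step.mono (subset_univ S)) _ _ (h e he)
  exact ⟨.head' h1 h2, .tail' h2 h1⟩

/-- The signed count of strongly semiconnected subgraphs detects acyclicity. -/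
theorem sum_SSC (G : DG n k) :
    ∑ S : Finset (Fin k), (if SSC G S then (-1 : R) ^ (S.card + beta0 G S) else 0) =
      if Acyclic G univ then (-1) ^ n else 0 := by
  set U : Finset (Fin n) := univ.filter fun v => Relation.TransGen (step G univ) v v with hUdef
  have hmem : ∀ v, v ∈ U ↔ Relation.TransGen (step G univ) v v := by simp [hUdef]
  set E : Finset (Fin k) := univ.filter fun e => (G e).1 ∈ U ∧ (G e).2 ∈ U with hEdef
  have hsub : ∀ S, SSC G S → S ⊆ E := fun S hS e he => by
    simpa [hEdef, hmem] using hS.transGen_endpoints he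
  have hE : ∀ e ∈ E, (G e).1 ∈ U ∧ (G e).2 ∈ U := fun e he => (mem_filter.1 he).2
  have hsum : ∑ S : Finset (Fin k), (if SSC G S then (-1 : R) ^ (S.card + beta0 G S) else 0) =
      ∑ S ∈ E.powerset with SSC G S, (-1 : R) ^ (S.card + beta0 G S) := by
    rw [← sum_filter]
    refine sum_congr ?_ fun _ _ => rfl
    ext S
    simpa using hsub S
  rw [hsum]
  rcases U.eq_empty_or_nonempty with hU | hU
  · have hE0 : E = ∅ := by
      refine eq_empty_of_forall_notMem fun e he => ?_
      have := (hE e he).1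
      simp [hU] at this
    have hac : Acyclic G univ := fun a ha => by
      have := (hmem a).2 ha
      simp [hU] at this
    have hss : SSC G (∅ : Finset (Fin k)) := fun e he => absurd he (notMem_empty e)
    have hb : beta0 G (∅ : Finset (Fin k)) = n := by
      have : Function.Bijective (Quot.mk (adj G (∅ : Finset (Fin k)))) := by
        refine ⟨fun a b hab => ?_, Quot.mk_surjective⟩
        have := (hss.eqvGen_adj_iff a b).1 (Quot.eqvGen_exact hab)
        cases this with
        | refl => rfl
        | tail _ h => obtain ⟨e, he, _⟩ := h; simp at he
      rw [beta0, ← Nat.card_eq_of_bijective _ this, Nat.card_fin]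
    rw [hE0, if_pos hac, powerset_empty, filter_singleton, if_pos hss]
    simp [hb]
  · rw [if_neg, sum_SSC_eq_zero hU hE]
    · intro u hu
      obtain ⟨v, ⟨e, _, he⟩, hvu⟩ := Relation.TransGen.head'_iff.1 ((hmem u).1 hu)
      refine ⟨e, ?_, by rw [he]⟩
      simp only [hEdef, mem_filter, mem_univ, true_and, he]
      exact ⟨hu, (hmem v).2 (.tail' hvu ⟨e, mem_univ e, he⟩)⟩
    · obtain ⟨u, hu⟩ := hU
      exact fun h => h u ((hmem u).1 hu)

end CycleCore

section Loopify

variable {n k : ℕ}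

/-- Replace the edges of `G` with label in `T` by loops at their tails. -/
def loopify (G : DG n k) (T : Finset (Fin k)) : DG n k :=
  fun p => if p ∈ T then ((G p).1, (G p).1) else G p

lemma loopify_fst (G : DG n k) (T : Finset (Fin k)) (p : Fin k) :
    (loopify G T p).1 = (G p).1 := by
  rw [loopify]; split_ifs <;> rfl

lemma step_loopify_iff (G : DG n k) (T : Finset (Fin k)) (a b : Fin n) :
    step (loopify G T) univ a b ↔ step G Tᶜ a b ∨ a = b ∧ ∃ e ∈ T, (G e).1 = a := by
  simp only [step, loopify, mem_univ, true_and, mem_compl]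
  constructor
  · rintro ⟨e, he⟩
    split_ifs at he with h
    · obtain ⟨rfl, rfl⟩ := Prod.mk.inj he
      exact .inr ⟨rfl, e, h, rfl⟩
    · exact .inl ⟨e, h, he⟩
  · rintro (⟨e, h, he⟩ | ⟨rfl, e, h, rfl⟩)
    · exact ⟨e, by simpa [h] using he⟩
    · exact ⟨e, by simp [h]⟩

lemma reach_loopify_iff (G : DG n k) (T : Finset (Fin k)) (a b : Fin n) :
    Reach (loopify G T) univ a b ↔ Reach G Tᶜ a b := by
  constructor
  · intro h
    induction h with
    | refl => exact .refl
    | tail _ hs ih =>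
      rcases (step_loopify_iff G T _ _).1 hs with h | ⟨rfl, _⟩
      · exact ih.tail h
      · exact ih
  · exact Relation.ReflTransGen.mono (fun _ _ h => (step_loopify_iff G T _ _).2 (.inl h)) _ _

lemma SSC_loopify_iff (G : DG n k) (T : Finset (Fin k)) :
    SSC (loopify G T) univ ↔ SSC G Tᶜ := by
  have h : ∀ e, OnCycle (loopify G T) univ e ↔ e ∈ T ∨ OnCycle G Tᶜ e := fun e => by
    rw [OnCycle, ← Reach, reach_loopify_iff]
    by_cases he : e ∈ T
    · simp only [loopify, he, if_true, true_or, iff_true]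
      exact .refl
    · simp [loopify, he, OnCycle, Reach]
  simp only [SSC, h, mem_univ, true_imp_iff, mem_compl]
  exact forall_congr' fun e => or_iff_not_imp_left

lemma beta0_loopify {G : DG n k} {T : Finset (Fin k)} (h : SSC G Tᶜ) :
    beta0 (loopify G T) univ = beta0 G Tᶜ := by
  rw [beta0, beta0, card_quot_eq_card_image, card_quot_eq_card_image]
  simp only [((SSC_loopify_iff G T).2 h).eqvGen_adj_iff, h.eqvGen_adj_iff, reach_loopify_iff]

lemma isolated_loopify_iff {G : DG n k} {T : Finset (Fin k)} (h : SSC G Tᶜ) (v : Fin n) :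
    isolated (loopify G T) v ↔ isSink G v := by
  refine ⟨fun hv e => loopify_fst G T e ▸ (hv e).1, fun hv e => ?_⟩
  refine ⟨(loopify_fst G T e).symm ▸ hv e, ?_⟩
  rw [loopify]
  split_ifs with he
  · exact hv e
  · rintro rfl
    rcases Relation.ReflTransGen.cases_head (h e (by simpa using he)) with h | ⟨_, ⟨e', _, h⟩, _⟩
    · exact hv e h.symm
    · exact hv e' (by rw [h])

lemma SSCset_loopify_iff (G : DG n k) (T : Finset (Fin k)) (I : Finset (Fin n)) :
    SSCset n k I (loopify G T) ↔ SSC G Tᶜ ∧ {v | isSink G v} = (I : Set (Fin n)) := by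
  rw [SSCset, SSC_loopify_iff]
  refine and_congr_right fun h => ?_
  simp only [isolated_loopify_iff h]

end Loopify

section Operators

variable {n k : ℕ} {R : Type*} [CommRing R]

lemma B_apply (p : Fin k) (x : GS R n k) (H : DG n k) :
    B n k p x H = if (H p).1 = (H p).2 then 0 else
      x H - x (Function.update H p ((H p).1, (H p).1)) := by
  induction x using Finsupp.induction_linear with
  | zero => simp
  | add x y hx hy =>
    rw [map_add, Finsupp.add_apply, hx, hy]
    split_ifs
    · simp
    · simp only [Finsupp.add_apply]; ring
  | single G c =>
    have hB : B n k p (Finsupp.single G c) = c • Bsingle n k p G := by simp [B]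
    rw [hB, Bsingle, Finsupp.smul_apply, smul_eq_mul]
    split_ifs with hG hH hH
    · rw [Finsupp.neg_apply, Finsupp.finsetSum_apply, sum_eq_zero, neg_zero, mul_zero]
      intro b hb
      refine Finsupp.single_eq_of_ne ?_
      rintro rfl
      simp only [Function.update_self] at hH
      exact (mem_filter.1 hb).2 hH.symm
    · have hGH : H ≠ G := fun h => hH (h ▸ hG)
      rw [Finsupp.single_eq_of_ne hGH, Finsupp.neg_apply, Finsupp.finsetSum_apply]
      by_cases h : Function.update H p ((H p).1, (H p).1) = G
      · subst h
        simp only [Function.update_self, Function.update_idem, Finsupp.single_eq_same]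
        rw [sum_eq_single_of_mem (H p).2 (by simpa using Ne.symm hH)]
        · simp
        · intro b _ hb
          refine Finsupp.single_eq_of_ne fun h => hb ?_
          rw [h, Function.update_self]
      · rw [Finsupp.single_eq_of_ne h, sum_eq_zero]
        · simp
        · intro b _
          refine Finsupp.single_eq_of_ne fun hb => h ?_
          subst hb
          simp only [Function.update_self, Function.update_idem]
          conv_lhs => rw [show ((G p).1, (G p).1) = G p from Prod.ext rfl hG]
          exact Function.update_eq_self p G
    · rw [Finsupp.single_eq_of_ne, mul_zero]
      exact fun h => hG (h ▸ hH)
    · have : Function.update H p ((H p).1, (H p).1) ≠ G := fun h => hG (by simp [← h])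
      rw [Finsupp.single_eq_of_ne this, sub_zero, Finsupp.single_apply, Finsupp.single_apply]
      split_ifs <;> simp

lemma prod_map_B_apply (l : List (Fin k)) (hl : l.Nodup) (x : GS R n k) (H : DG n k) :
    (l.map fun p => B (R := R) n k p).prod x H =
      if ∃ p ∈ l, (H p).1 = (H p).2 then 0 else
        ∑ T ∈ l.toFinset.powerset, (-1 : R) ^ T.card * x (loopify H T) := by
  induction l generalizing H with
  | nil => simp [show loopify H ∅ = H from funext fun p => by simp [loopify]]
  | cons p l ih =>
    obtain ⟨hp, hl⟩ := List.nodup_cons.1 hl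
    rw [List.map_cons, List.prod_cons, Module.End.mul_apply, B_apply, ih hl, ih hl]
    have hne : ∀ q ∈ l, q ≠ p := fun q hq h => hp (h ▸ hq)
    have h1 : (∃ q ∈ l, (Function.update H p ((H p).1, (H p).1) q).1 =
        (Function.update H p ((H p).1, (H p).1) q).2) ↔ ∃ q ∈ l, (H q).1 = (H q).2 :=
      exists_congr fun q => and_congr_right fun hq => by
        rw [Function.update_of_ne (hne q hq)]
    simp only [h1, List.mem_cons, exists_eq_or_imp, List.toFinset_cons]
    by_cases hloop : (H p).1 = (H p).2
    · simp [hloop]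
    by_cases hl' : ∃ q ∈ l, (H q).1 = (H q).2
    · simp only [hl', or_true, if_true, sub_self, ite_self]
    simp only [hloop, hl', or_self, if_false]
    have hp' : p ∉ l.toFinset := by simpa using hp
    rw [sum_powerset_insert hp', sub_eq_add_neg, ← sum_neg_distrib]
    congr 1
    refine sum_congr rfl fun T hT => ?_
    have hpT : p ∉ T := fun h => hp' (mem_powerset.1 hT h)
    have : loopify (Function.update H p ((H p).1, (H p).1)) T = loopify H (insert p T) := by
      funext q
      by_cases hq : q = p
      · subst hq; simp [loopify, hpT]
      · simp [loopify, hq]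
    rw [this, card_insert_of_notMem hpT, pow_succ]
    ring

lemma Laplace_apply (x : GS R n k) (H : DG n k) :
    Laplace n k x H = if ∃ p, (H p).1 = (H p).2 then 0 else
      ∑ T : Finset (Fin k), (-1 : R) ^ T.card * x (loopify H T) := by
  rw [Laplace, List.ofFn_eq_map, prod_map_B_apply _ (List.nodup_finRange k)]
  simp

lemma U_apply (P : DG n k → Prop) (H : DG n k) : U R n k P H = if P H then 1 else 0 := by
  rw [U, Finsupp.finsetSum_apply, sum_eq_single H]
  · split_ifs <;> simp
  · intro G _ hG
    split_ifs <;> simp [hG]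
  · simp

lemma X_apply (P : DG n k → Prop) (H : DG n k) :
    X R n k P H = if P H then (-1) ^ beta0 H univ else 0 := by
  rw [X, Finsupp.finsetSum_apply, sum_eq_single H]
  · split_ifs <;> simp
  · intro G _ hG
    split_ifs <;> simp [hG]
  · simp

lemma Laplace_X_SSCset (I : Finset (Fin n)) :
    Laplace n k (X R n k (SSCset n k I)) = (-1 : R) ^ (n + k) • U R n k (ACset n k I) := by
  ext H
  rw [Laplace_apply, Finsupp.smul_apply, U_apply, smul_eq_mul]
  by_cases hloop : ∃ p, (H p).1 = (H p).2
  · have hac : ¬ ACset n k I H := fun hac => by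
      obtain ⟨p, hp⟩ := hloop
      exact hac.1 (H p).1 (.single ⟨p, mem_univ p, Prod.ext rfl hp.symm⟩)
    rw [if_pos hloop, if_neg hac, mul_zero]
  rw [if_neg hloop]
  have hterm : ∀ T : Finset (Fin k), (-1 : R) ^ T.card * X R n k (SSCset n k I) (loopify H T) =
      if {v | isSink H v} = (I : Set (Fin n)) then
        (-1) ^ k * (if SSC H Tᶜ then (-1 : R) ^ (Tᶜ.card + beta0 H Tᶜ) else 0) else 0 := by
    intro T
    rw [X_apply, SSCset_loopify_iff]
    by_cases hT : SSC H Tᶜ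
    · have hk : T.card + Tᶜ.card = k := by simp
      have hsq : (-1 : R) ^ Tᶜ.card * (-1) ^ Tᶜ.card = 1 := by
        rw [← mul_pow]; simp
      rw [beta0_loopify hT]
      simp only [hT, true_and, if_true, mul_ite, mul_zero]
      split_ifs
      · rw [← congrArg ((-1 : R) ^ ·) hk]
        rw [pow_add, pow_add]
        linear_combination (-(-1 : R) ^ T.card * (-1) ^ beta0 H Tᶜ) * hsq
      · rfl
    · simp [hT]
  simp only [hterm]
  refine (Equiv.sum_comp (compl_involutive (α := Finset (Fin k))).toPerm fun S =>
    if {v | isSink H v} = (I : Set (Fin n)) then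
      (-1) ^ k * (if SSC H S then (-1 : R) ^ (S.card + beta0 H S) else 0) else 0).trans ?_
  by_cases hI : {v | isSink H v} = (I : Set (Fin n))
  · simp only [ACset, hI, if_true, and_true]
    rw [← mul_sum, sum_SSC, pow_add]
    split_ifs <;> ring
  · simp [ACset, hI]

end Operators

end DG

/-- abstract matrix-tree theorem for diagonal minors.
`Δ(det_{n,k}^I) = ((−1)^n / k!) · U(AC_{n,k}^I)` in `Graph_{n,k}`. -/
theorem laplace_detI (n k : ℕ) (hn : 1 ≤ n) (I : Finset (Fin n)) :
    DG.Laplace (R := ℂ) n k (DG.detI ℂ n k I)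
      = (((-1 : ℂ) ^ n) / (k ! : ℂ)) • DG.U ℂ n k (DG.ACset n k I) := by
  rw [DG.detI, map_smul, DG.Laplace_X_SSCset, smul_smul]
  congr 1
  have : (-1 : ℂ) ^ k * (-1) ^ k = 1 := by rw [← mul_pow]; simp
  rw [pow_add, div_mul_eq_mul_div]
  congr 1
  linear_combination (-1 : ℂ) ^ n * this
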